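/- For every φ ∈ S²₀₊, the operator ϑφ satisfies ρ(ϑφ) = 2φ and ρ₁₃(ϑφ) = -(m+2)φ. -/

import Mathlib

open Module
open scoped RealInnerProductSpace

variable {V : Type*} [NormedAddCommGroup V] [InnerProductSpace ℝ V] [FiniteDimensional ℝ V]

/-- The Ricci tensor `ρ(A)(x,y) = Tr (z ↦ A(z,x)y)`. -/
noncomputable def rho (A : V →ₗ[ℝ] V →ₗ[ℝ] V →ₗ[ℝ] V) (x y : V) : ℝ :=
  LinearMap.trace ℝ V ((A.flip x).flip y)

/-- for `φ ∈ S²₀₊`, `ρ(ϑφ) = 2φ` and `ρ₁₃(ϑφ) = -(m+2)φ`. -/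
theorem statement13 {m : ℕ} (e : OrthonormalBasis (Fin m) ℝ V)
    (J : V →ₗ[ℝ] V) (hJ : ∀ v, J (J v) = -v)
    (hJinner : ∀ x y : V, ⟪J x, J y⟫ = ⟪x, y⟫)
    (φ : V →ₗ[ℝ] V →ₗ[ℝ] ℝ) (hsym : ∀ x y, φ x y = φ y x)
    (hJφ : ∀ x y, φ (J x) (J y) = φ x y) (htr : ∑ i, φ (e i) (e i) = 0)
    (T : V →ₗ[ℝ] V →ₗ[ℝ] V →ₗ[ℝ] V)
    (hT : ∀ x y z w : V, ⟪T x y z, w⟫ =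
      φ x w * ⟪y, z⟫ - φ y w * ⟪x, z⟫ + φ x (J w) * ⟪y, J z⟫ - φ y (J w) * ⟪x, J z⟫
        - 2 * φ z (J w) * ⟪x, J y⟫) :
    (∀ x y, rho T x y = 2 * φ x y) ∧
    (∀ x y, (∑ i, ⟪T (e i) x (e i), y⟫) = -((m : ℝ) + 2) * φ x y) := by
  have key : ∀ (f : V →ₗ[ℝ] ℝ) (v : V), ∑ i, f (e i) * ⟪e i, v⟫ = f v := by
    intro f v
    conv_rhs => rw [← e.sum_repr' v]
    simp [map_sum, mul_comm]
  have hskew : ∀ x y : V, ⟪x, J y⟫ = -⟪y, J x⟫ := by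
    intro x y
    rw [← hJinner x (J y), hJ, inner_neg_right, real_inner_comm]
  have hself : ∀ x : V, ⟪x, J x⟫ = 0 := fun x => by linarith [hskew x x]
  have hφself : ∀ x : V, φ x (J x) = 0 := by
    intro x
    have h := hJφ x (J x)
    rw [hJ, map_neg, hsym (J x) x] at h
    linarith
  constructor
  · intro x y
    have h1 : rho T x y = ∑ i, ⟪T (e i) x y, e i⟫ := by
      unfold rho
      rw [LinearMap.trace_eq_sum_inner _ e]
      exact Finset.sum_congr rfl fun i _ => by
        rw [real_inner_comm]; rfl
    have k1 := key (φ x) y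
    have k2 := key ((φ x).comp J) (J y)
    have k3 := key ((φ y).comp J) (J x)
    simp only [LinearMap.comp_apply, hJ, map_neg] at k2 k3
    rw [h1]
    simp only [hT, hφself, zero_mul, add_zero, mul_assoc, Finset.sum_sub_distrib,
      ← Finset.mul_sum, ← Finset.sum_mul, htr]
    rw [k1, k2, k3, hsym y x]
    ring
  · intro x y
    have k1 := key (φ.flip y) x
    have k2 := key (φ.flip (J y)) (J x)
    simp only [LinearMap.flip_apply, hJφ] at k1 k2
    have h : ∀ i, ⟪T (e i) x (e i), y⟫ = φ (e i) y * ⟪e i, x⟫ - φ x y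
        - 3 * (φ (e i) (J y) * ⟪e i, J x⟫) := by
      intro i
      rw [hT, hself, hskew x (e i), real_inner_comm (e i) x, real_inner_self_eq_norm_sq (e i),
        e.norm_eq_one]
      ring
    simp only [h, Finset.sum_sub_distrib, ← Finset.mul_sum, k1, k2]
    simp
    ring
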